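/- arXiv:1704.08423 — 3 statements merged into one kernel-verified Lean document; each statement's English description precedes it below -/
import Mathlib

section
/- Let E, A ∈ ℝ^{n×n}. The matrix pencil (E, A) is regular, i.e. there exists c ∈ ℂ with det(cE − A) ≠ 0, if and only if there exist invertible matrices Q, P ∈ ℝ^{n×n}, a splitting n = n₁ + n₂, a matrix A₁ ∈ ℝ^{n₁×n₁} and a nilpotent matrix N ∈ ℝ^{n₂×n₂} such that QEP = diag(I_{n₁}, N) and QAP = diag(A₁, I_{n₂}) (block-diagonal matrices). -/
open Matrix

/-- The reindexing equivalence for a block splitting `n = n₁ + n₂`. -/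
def blockEquiv {n n₁ n₂ : ℕ} (h : n = n₁ + n₂) : Fin n₁ ⊕ Fin n₂ ≃ Fin n :=
  finSumFinEquiv.trans (finCongr h.symm)

/-- The Fitting decomposition of an endomorphism, as a direct sum of an automorphism and a
nilpotent endomorphism. -/
theorem LinearMap.exists_fitting_decomposition {K V : Type*} [Field K] [AddCommGroup V] [Module K V]
    [FiniteDimensional K V] (f : Module.End K V) :
    ∃ (U W : Submodule K V) (_ : IsCompl U W) (g : Module.End K U) (g' : Module.End K W),
      IsUnit g ∧ IsNilpotent g' ∧ (∀ x, (g x : V) = f x) ∧ ∀ x, (g' x : V) = f x := by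
  obtain ⟨k, hk⟩ := Filter.eventually_atTop.mp f.eventually_isCompl_ker_pow_range_pow
  have hc := hk (k + 1) (by omega)
  have hU : ∀ x ∈ LinearMap.range (f ^ (k + 1)), f x ∈ LinearMap.range (f ^ (k + 1)) := by
    rintro _ ⟨y, rfl⟩
    exact ⟨f y, by rw [← Module.End.mul_apply, ← Module.End.mul_apply, ← pow_succ, ← pow_succ']⟩
  have hW : ∀ x ∈ LinearMap.ker (f ^ (k + 1)), f x ∈ LinearMap.ker (f ^ (k + 1)) := by
    intro x hx
    rw [LinearMap.mem_ker] at hx ⊢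
    rw [← Module.End.mul_apply, ← pow_succ, pow_succ', Module.End.mul_apply, hx, map_zero]
  refine ⟨_, _, hc.symm, f.restrict hU, f.restrict hW, ?_, ⟨k + 1, ?_⟩, fun _ ↦ rfl, fun _ ↦ rfl⟩
  · rw [LinearMap.isUnit_iff_ker_eq_bot, LinearMap.ker_eq_bot']
    intro x hx
    have hx' : f x = 0 := congrArg Subtype.val hx
    have hker : (x : V) ∈ LinearMap.ker (f ^ (k + 1)) := by
      simp [pow_succ, Module.End.mul_apply, hx']
    exact Subtype.ext (Submodule.disjoint_def.mp hc.disjoint _ hker x.2)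
  · rw [Module.End.pow_restrict]
    ext x
    exact x.2

/-- Every square matrix over a field is similar to a block-diagonal matrix with an invertible
block and a nilpotent block. -/
theorem Matrix.exists_fitting_decomposition {K : Type*} [Field K] {n : ℕ}
    (M : Matrix (Fin n) (Fin n) K) :
    ∃ (n₁ n₂ : ℕ) (h : n = n₁ + n₂) (R P : Matrix (Fin n) (Fin n) K)
      (J : Matrix (Fin n₁) (Fin n₁) K) (N : Matrix (Fin n₂) (Fin n₂) K),
      R * P = 1 ∧ IsUnit J ∧ IsNilpotent N ∧
      (R * M * P).submatrix (blockEquiv h) (blockEquiv h) = Matrix.fromBlocks J 0 0 N := by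
  obtain ⟨U, W, hc, g, g', hg, hg', hgf, hgf'⟩ :=
    LinearMap.exists_fitting_decomposition (Matrix.toLin' M)
  have h : n = Module.finrank K U + Module.finrank K W := by
    rw [Submodule.finrank_add_eq_of_isCompl hc, Module.finrank_fin_fun]
  let bU := Module.finBasis K U
  let bW := Module.finBasis K W
  let e := Submodule.prodEquivOfIsCompl U W hc
  let c := (bU.prod bW).map e
  let b := c.reindex (blockEquiv h)
  let s := Pi.basisFun K (Fin n)
  refine ⟨_, _, h, b.toMatrix s, s.toMatrix b, LinearMap.toMatrix bU bU g,
    LinearMap.toMatrix bW bW g', b.toMatrix_mul_toMatrix_flip s, ?_, ?_, ?_⟩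
  · exact hg.map (LinearMap.toMatrixAlgEquiv bU)
  · exact hg'.map (LinearMap.toMatrixAlgEquiv bW)
  · have hM : M = LinearMap.toMatrix s s (Matrix.toLin' M) := by
      rw [LinearMap.toMatrix_eq_toMatrix', LinearMap.toMatrix'_toLin']
    have hcomm : Matrix.toLin' M ∘ₗ e.toLinearMap = e.toLinearMap ∘ₗ g.prodMap g' := by
      ext1 <;> ext1 x <;> simp [e, hgf, hgf']
    rw [hM, basis_toMatrix_mul_linearMap_toMatrix_mul_basis_toMatrix,
      ← LinearMap.toMatrix_prodMap]
    ext i j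
    have hj := LinearMap.congr_fun hcomm (bU.prod bW j)
    simp only [LinearMap.comp_apply, LinearEquiv.coe_coe] at hj
    simp [LinearMap.toMatrix_apply, b, c, hj, -Matrix.toLin'_apply, -Module.Basis.prod_apply]

theorem IsNilpotent.isUnit_smul_sub_one {R S : Type*} [CommSemiring R] [Ring S] [Algebra R S]
    {N : S} (hN : IsNilpotent N) (r : R) : IsUnit (r • N - 1) :=
  (hN.smul r).isUnit_sub_one

/-- A pencil which is nonsingular at a point of the base field admits a Weierstrass decomposition. -/
theorem exists_weierstrass_decomposition {K : Type*} [Field K] {n : ℕ}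
    (E A : Matrix (Fin n) (Fin n) K) (r : K) (hr : (r • E - A).det ≠ 0) :
    ∃ (n₁ n₂ : ℕ) (h : n = n₁ + n₂) (Q P : Matrix (Fin n) (Fin n) K)
      (A₁ : Matrix (Fin n₁) (Fin n₁) K) (N : Matrix (Fin n₂) (Fin n₂) K),
      IsUnit Q ∧ IsUnit P ∧ IsNilpotent N ∧
      (Q * E * P).submatrix (blockEquiv h) (blockEquiv h) = Matrix.fromBlocks 1 0 0 N ∧
      (Q * A * P).submatrix (blockEquiv h) (blockEquiv h) = Matrix.fromBlocks A₁ 0 0 1 := by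
  set M := r • E - A with hMdef
  have hM : IsUnit M.det := hr.isUnit
  obtain ⟨n₁, n₂, h, R, P, J, N, hRP, hJ, hN, hF⟩ :=
    Matrix.exists_fitting_decomposition (M⁻¹ * E)
  set e := blockEquiv h
  have hA : (R * (M⁻¹ * A) * P).submatrix e e = fromBlocks (r • J - 1) 0 0 (r • N - 1) := by
    have hA' : R * (M⁻¹ * A) * P = r • (R * (M⁻¹ * E) * P) - 1 := by
      have : A = r • E - M := by rw [hMdef]; abel
      rw [this, mul_sub, Matrix.nonsing_inv_mul _ hM, mul_sub, sub_mul, mul_one, hRP]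
      simp
    rw [hA', Matrix.submatrix_sub, Matrix.submatrix_smul, Pi.sub_apply, Pi.sub_apply, Pi.smul_apply,
      Pi.smul_apply, hF, Matrix.submatrix_one_equiv, ← fromBlocks_one, fromBlocks_smul, sub_eq_add_neg,
      fromBlocks_neg, fromBlocks_add]
    simp [sub_eq_add_neg]
  obtain ⟨u, hu⟩ := hJ
  obtain ⟨v, hv⟩ := hN.isUnit_smul_sub_one r
  let D : Matrix (Fin n₁ ⊕ Fin n₂) (Fin n₁ ⊕ Fin n₂) K :=
    fromBlocks (↑u⁻¹ : Matrix _ _ K) 0 0 (↑v⁻¹ : Matrix _ _ K)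
  have hD : IsUnit D := by
    rw [Matrix.isUnit_iff_isUnit_det, Matrix.det_fromBlocks_zero₂₁]
    exact ((Matrix.isUnit_iff_isUnit_det _).mp u⁻¹.isUnit).mul
      ((Matrix.isUnit_iff_isUnit_det _).mp v⁻¹.isUnit)
  have hQ (X : Matrix (Fin n) (Fin n) K) :
      (D.submatrix e.symm e.symm * R * M⁻¹ * X * P).submatrix e e =
        D * (R * (M⁻¹ * X) * P).submatrix e e := by
    simp only [mul_assoc]
    rw [← Matrix.submatrix_mul_equiv _ _ _ e _, Matrix.submatrix_submatrix]
    simp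
  have hcomm : Commute N (r • N - 1) :=
    ((Commute.refl N).smul_right r).sub_right (Commute.one_right N)
  refine ⟨n₁, n₂, h, D.submatrix e.symm e.symm * R * M⁻¹, P,
    (↑u⁻¹ : Matrix _ _ K) * (r • J - 1), (↑v⁻¹ : Matrix _ _ K) * N, ?_, ?_, ?_, ?_, ?_⟩
  · refine (IsUnit.mul ?_ (IsUnit.of_mul_eq_one _ hRP)).mul ?_
    · exact hD.map (Matrix.reindexAlgEquiv K K e)
    · exact (Matrix.isUnit_nonsing_inv_iff).mpr ((Matrix.isUnit_iff_isUnit_det _).mpr hM)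
  · exact IsUnit.of_mul_eq_one_right _ hRP
  · rw [← hv] at hcomm
    exact hcomm.symm.units_inv_left.isNilpotent_mul_left hN
  · rw [hQ, hF, ← hu]
    simp [D, fromBlocks_multiply]
  · rw [hQ, hA, ← hv]
    simp [D, fromBlocks_multiply]

open Polynomial in
/-- A pencil over an infinite domain which is nonsingular at a point of an extension ring is
nonsingular at a point of the base. -/
theorem exists_det_smul_sub_ne_zero_of_map {K L m : Type*} [CommRing K] [IsDomain K] [Infinite K]
    [CommRing L] [Fintype m] [DecidableEq m] (φ : K →+* L) (E A : Matrix m m K) (c : L)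
    (hc : (c • E.map φ - A.map φ).det ≠ 0) : ∃ r : K, (r • E - A).det ≠ 0 := by
  by_contra! h
  have hp : ((X : K[X]) • E.map C - A.map C).det = 0 := by
    refine Polynomial.funext fun r ↦ ?_
    rw [← coe_evalRingHom, RingHom.map_det, map_zero, ← h r]
    congr 1
    ext i j
    simp [mul_comm r]
  apply hc
  rw [← map_zero (eval₂RingHom φ c), ← hp, RingHom.map_det]
  congr 1
  ext i j
  simp [mul_comm c]

theorem exists_det_smul_sub_ne_zero_of_weierstrass {K n n₁ n₂ : Type*} [Field K] [Infinite K]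
    [Fintype n] [DecidableEq n] [Fintype n₁] [DecidableEq n₁] [Fintype n₂] [DecidableEq n₂]
    (e : n₁ ⊕ n₂ ≃ n) {E A Q P : Matrix n n K} {A₁ : Matrix n₁ n₁ K} {N : Matrix n₂ n₂ K}
    (hN : IsNilpotent N)
    (hE : (Q * E * P).submatrix e e = fromBlocks 1 0 0 N)
    (hA : (Q * A * P).submatrix e e = fromBlocks A₁ 0 0 1) :
    ∃ r : K, (r • E - A).det ≠ 0 := by
  obtain ⟨r, hr⟩ : ∃ r, A₁.charpoly.eval r ≠ 0 := by
    by_contra! h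
    exact A₁.charpoly_monic.ne_zero (Polynomial.funext (by simpa using h))
  refine ⟨r, fun h0 ↦ ?_⟩
  have hblock : (Q * (r • E - A) * P).submatrix e e =
      fromBlocks (scalar n₁ r - A₁) 0 0 (r • N - 1) := by
    have hlin : Q * (r • E - A) * P = r • (Q * E * P) - Q * A * P := by
      simp [mul_sub, sub_mul]
    rw [hlin, Matrix.submatrix_sub, Matrix.submatrix_smul, Pi.sub_apply, Pi.sub_apply, Pi.smul_apply,
      Pi.smul_apply, hE, hA, fromBlocks_smul, sub_eq_add_neg, fromBlocks_neg, fromBlocks_add]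
    simp [sub_eq_add_neg, Matrix.smul_one_eq_diagonal]
  have hdet := congrArg Matrix.det hblock
  rw [Matrix.det_submatrix_equiv_self, Matrix.det_fromBlocks_zero₂₁, det_mul, det_mul, h0,
    mul_zero, zero_mul, ← Matrix.eval_charpoly] at hdet
  exact mul_ne_zero hr
    ((Matrix.isUnit_iff_isUnit_det _).mp (hN.isUnit_smul_sub_one r)).ne_zero hdet.symm

/-- the pencil `(E, A)` is regular (some `c : ℂ` has `det (c E - A) ≠ 0`)
iff there is a Weierstrass decomposition `Q E P = diag(I, N)`, `Q A P = diag(A₁, I)`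
with `N` nilpotent. -/
theorem stmt_0 {n : ℕ} (E A : Matrix (Fin n) (Fin n) ℝ) :
    (∃ c : ℂ, (c • E.map (Complex.ofReal) - A.map (Complex.ofReal)).det ≠ 0) ↔
    ∃ (n₁ n₂ : ℕ) (h : n = n₁ + n₂) (Q P : Matrix (Fin n) (Fin n) ℝ)
      (A₁ : Matrix (Fin n₁) (Fin n₁) ℝ) (N : Matrix (Fin n₂) (Fin n₂) ℝ),
      IsUnit Q ∧ IsUnit P ∧ IsNilpotent N ∧
      (Q * E * P).submatrix (blockEquiv h) (blockEquiv h) = Matrix.fromBlocks 1 0 0 N ∧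
      (Q * A * P).submatrix (blockEquiv h) (blockEquiv h) = Matrix.fromBlocks A₁ 0 0 1 := by
  constructor
  · rintro ⟨c, hc⟩
    obtain ⟨r, hr⟩ := exists_det_smul_sub_ne_zero_of_map Complex.ofRealHom E A c hc
    exact exists_weierstrass_decomposition E A r hr
  · rintro ⟨n₁, n₂, h, Q, P, A₁, N, -, -, hN, hE, hA⟩
    obtain ⟨r, hr⟩ := exists_det_smul_sub_ne_zero_of_weierstrass (blockEquiv h) hN hE hA
    refine ⟨r, ?_⟩
    have hmap : (r : ℂ) • E.map Complex.ofReal - A.map Complex.ofReal =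
        Complex.ofRealHom.mapMatrix (r • E - A) := by
      ext i j
      simp
    rw [hmap, ← RingHom.map_det]
    simpa using hr
end

section
/- Let E, A ∈ ℝ^{n×n} and suppose there exist invertible matrices Q, P ∈ ℝ^{n×n}, a splitting n = n₁ + n₂, a matrix A₁ ∈ ℝ^{n₁×n₁} and a nilpotent matrix N ∈ ℝ^{n₂×n₂} with QEP = diag(I_{n₁}, N) and QAP = diag(A₁, I_{n₂}). Then N = 0 if and only if for all vectors υ, ω ∈ ℝⁿ, the conditions Eυ = 0 and Aυ = Eω imply υ = 0. -/
open Matrix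

/-- The pencil condition for a block-diagonal pencil in Weierstrass form forces the nilpotent
block to vanish, and conversely. -/
theorem fromBlocks_nilpotent_eq_zero_iff {R l m : Type*} [CommRing R] [Fintype l] [Fintype m]
    [DecidableEq l] [DecidableEq m] (A₁ : Matrix l l R) {N : Matrix m m R} (hN : IsNilpotent N) :
    N = 0 ↔ ∀ v w : l ⊕ m → R, Matrix.fromBlocks (1 : Matrix l l R) 0 0 N *ᵥ v = 0 →
      Matrix.fromBlocks A₁ 0 0 (1 : Matrix m m R) *ᵥ v =
        Matrix.fromBlocks (1 : Matrix l l R) 0 0 N *ᵥ w → v = 0 := by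
  constructor
  · rintro rfl v w hv hw
    ext (i | i)
    · simpa [Matrix.fromBlocks_mulVec] using congrFun hv (Sum.inl i)
    · simpa [Matrix.fromBlocks_mulVec] using congrFun hw (Sum.inr i)
  · intro H
    have key (x : m → R) (hx : N *ᵥ (N *ᵥ x) = 0) : N *ᵥ x = 0 := by
      have hv := H (Sum.elim 0 (N *ᵥ x)) (Sum.elim 0 x)
        (by simp [Matrix.fromBlocks_mulVec, hx]) (by simp [Matrix.fromBlocks_mulVec])
      ext i
      exact congrFun hv (Sum.inr i)
    have step (k : ℕ) (hk : N ^ (k + 2) = 0) : N ^ (k + 1) = 0 := by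
      refine Matrix.ext_iff_mulVec.mpr fun x => ?_
      have := key (N ^ k *ᵥ x) (by
        rw [Matrix.mulVec_mulVec, Matrix.mulVec_mulVec, mul_assoc, ← pow_succ', ← pow_succ', hk,
          Matrix.zero_mulVec])
      rwa [Matrix.mulVec_mulVec, ← pow_succ', ← Matrix.zero_mulVec x] at this
    have descend (k : ℕ) (hk : N ^ (k + 1) = 0) : N = 0 := by
      induction k with
      | zero => simpa using hk
      | succ k ih => exact ih (step k hk)
    obtain ⟨k, hk⟩ := hN
    exact descend k (by rw [pow_succ, hk, zero_mul])

/-- The condition that `E v = 0` and `A v = E w` imply `v = 0` is invariant under strict equivalence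
of the pencil. -/
theorem pencil_condition_iff_of_isUnit {R m : Type*} [CommRing R] [Fintype m] [DecidableEq m]
    (E A : Matrix m m R) {Q P : Matrix m m R} (hQ : IsUnit Q) (hP : IsUnit P) :
    (∀ v w : m → R, E *ᵥ v = 0 → A *ᵥ v = E *ᵥ w → v = 0) ↔
      ∀ v w : m → R, (Q * E * P) *ᵥ v = 0 → (Q * A * P) *ᵥ v = (Q * E * P) *ᵥ w → v = 0 := by
  have hQi := Matrix.mulVec_injective_of_isUnit hQ
  have hPi := Matrix.mulVec_injective_of_isUnit hP
  have hPs := Matrix.mulVec_surjective_iff_isUnit.mpr hP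
  have hQ0 (x : m → R) : Q *ᵥ x = 0 ↔ x = 0 := hQi.eq_iff' (Matrix.mulVec_zero Q)
  have hP0 (x : m → R) : P *ᵥ x = 0 ↔ x = 0 := hPi.eq_iff' (Matrix.mulVec_zero P)
  simp only [← Matrix.mulVec_mulVec, hQ0, hQi.eq_iff]
  rw [hPs.forall₂]
  simp only [hP0]

/-- The condition that `E v = 0` and `A v = E w` imply `v = 0` is invariant under reindexing. -/
theorem pencil_condition_iff_submatrix {R l m : Type*} [CommRing R] [Fintype l] [Fintype m]
    (E A : Matrix m m R) (e : l ≃ m) :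
    (∀ v w : m → R, E *ᵥ v = 0 → A *ᵥ v = E *ᵥ w → v = 0) ↔
      ∀ v w : l → R, E.submatrix e e *ᵥ v = 0 → A.submatrix e e *ᵥ v = E.submatrix e e *ᵥ w →
        v = 0 := by
  have hs : Function.Surjective fun v : m → R => v ∘ e := e.injective.surjective_comp_right
  have hi : Function.Injective fun v : m → R => v ∘ e := e.surjective.injective_comp_right
  have h0 (x : m → R) : x ∘ e = 0 ↔ x = 0 := hi.eq_iff' rfl
  have he (x y : m → R) : x ∘ e = y ∘ e ↔ x = y := hi.eq_iff
  conv_rhs => rw [hs.forall₂]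
  simp only [Matrix.submatrix_mulVec_equiv, Function.comp_assoc, Equiv.self_comp_symm,
    Function.comp_id, h0, he]

/-- given a Weierstrass decomposition of the pencil `(E, A)`,
`N = 0` iff (`Eυ = 0` and `Aυ = Eω` imply `υ = 0`). -/
theorem stmt_1 {n n₁ n₂ : ℕ} (E A : Matrix (Fin n) (Fin n) ℝ)
    (h : n = n₁ + n₂) (Q P : Matrix (Fin n) (Fin n) ℝ)
    (A₁ : Matrix (Fin n₁) (Fin n₁) ℝ) (N : Matrix (Fin n₂) (Fin n₂) ℝ)
    (hQ : IsUnit Q) (hP : IsUnit P) (hN : IsNilpotent N)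
    (hE : (Q * E * P).submatrix (blockEquiv h) (blockEquiv h) = Matrix.fromBlocks 1 0 0 N)
    (hA : (Q * A * P).submatrix (blockEquiv h) (blockEquiv h) = Matrix.fromBlocks A₁ 0 0 1) :
    N = 0 ↔ ∀ υ ω : Fin n → ℝ, E *ᵥ υ = 0 → A *ᵥ υ = E *ᵥ ω → υ = 0 := by
  rw [pencil_condition_iff_of_isUnit E A hQ hP,
    pencil_condition_iff_submatrix _ _ (blockEquiv h), hE, hA]
  exact fromBlocks_nilpotent_eq_zero_iff A₁ hN
end

section
/- Let E, A ∈ ℝ^{n×n} with rank E = r, let E₀ ∈ ℝ^{n×(n−r)} have full column rank with EᵀE₀ = 0, let Φ ∈ ℝ^{d×d} be symmetric and Ψ ∈ ℝ^{d×d}. If there exist a symmetric positive definite P ∈ ℝ^{n×n} and Q ∈ ℝ^{(n−r)×n} such that Φ⊗(EᵀPE) + Sym{Ψ⊗(EᵀPA) + I_d⊗(QᵀE₀ᵀA)} is negative definite, then for every λ ∈ ℂ and every v ∈ ℂⁿ with Av = λEv and Ev ≠ 0, the Hermitian matrix Φ + λΨ + λ̄Ψᵀ is negative definite. -/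
open Matrix Kronecker
open scoped ComplexOrder

/-- `Sym M = M + Mᵀ`. -/
def matSym {m : Type*} (M : Matrix m m ℝ) : Matrix m m ℝ := M + Mᵀ

/-- A real matrix is negative definite iff its negation is positive definite. -/
def NegDef {m : Type*} [Fintype m] (M : Matrix m m ℝ) : Prop := (-M).PosDef

/-- A complex matrix is (Hermitian) negative definite iff its negation is positive definite. -/
def NegDefC {m : Type*} [Fintype m] (M : Matrix m m ℂ) : Prop := (-M).PosDef

/-- The Hermitian matrix `f_D(z) = Φ + z Ψ + z̄ Ψᵀ` defining the LMI region. -/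
def lmiMat {d : ℕ} (Φ Ψ : Matrix (Fin d) (Fin d) ℝ) (z : ℂ) : Matrix (Fin d) (Fin d) ℂ :=
  Φ.map Complex.ofReal + z • Ψ.map Complex.ofReal + (starRingEnd ℂ z) • Ψᵀ.map Complex.ofReal

/-- The complexification of a real positive definite matrix is positive definite. -/
lemma Matrix.PosDef.map_ofReal {m : Type*} [Fintype m] {M : Matrix m m ℝ} (hM : M.PosDef) :
    (M.map Complex.ofReal).PosDef := by
  classical
  obtain ⟨y, hy⟩ : ∃ y : Matrix m m ℝ, M = yᴴ * y := by
    open scoped MatrixOrder in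
    exact CStarAlgebra.nonneg_iff_eq_star_mul_self.mp hM.posSemidef.nonneg
  have hu : IsUnit y := by
    have h := hM.isUnit
    rw [isUnit_iff_isUnit_det, hy, det_mul] at h
    exact (isUnit_iff_isUnit_det _).mpr (isUnit_of_mul_isUnit_right h)
  have hu' : IsUnit (y.map Complex.ofReal) := hu.map Complex.ofRealHom.mapMatrix
  have hM' : M.map Complex.ofReal = (y.map Complex.ofReal)ᴴ * y.map Complex.ofReal := by
    rw [hy]
    ext i j
    simp [mul_apply]
  rw [hM']
  exact .conjTranspose_mul_self _ (mulVec_injective_of_isUnit hu')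

lemma Matrix.map_ofReal_mul {l m n : Type*} [Fintype m] (M : Matrix l m ℝ) (N : Matrix m n ℝ) :
    (M * N).map Complex.ofReal = M.map Complex.ofReal * N.map Complex.ofReal :=
  Matrix.map_mul (f := Complex.ofRealHom)

lemma Matrix.map_ofReal_kronecker {l m n p : Type*} (M : Matrix l m ℝ) (N : Matrix n p ℝ) :
    (M ⊗ₖ N).map Complex.ofReal = M.map Complex.ofReal ⊗ₖ N.map Complex.ofReal := by
  ext; simp

lemma Matrix.conjTranspose_map_ofReal {m n : Type*} (M : Matrix m n ℝ) :
    (M.map Complex.ofReal)ᴴ = Mᵀ.map Complex.ofReal := by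
  ext; simp

lemma Matrix.replicateCol_mulVec_injective {m : Type*} {v : m → ℂ} (hv : v ≠ 0) :
    Function.Injective (replicateCol Unit v).mulVec := by
  intro x y h
  obtain ⟨k, hk⟩ := Function.ne_iff.mp hv
  have h' := congrFun h k
  simp only [mulVec, dotProduct, replicateCol_apply, Finset.univ_unique, Finset.sum_singleton] at h'
  funext i
  exact mul_left_cancel₀ hk h'

lemma Matrix.one_kronecker_replicateCol_mulVec_injective {d m : Type*} [Fintype d] [DecidableEq d]
    {v : m → ℂ} (hv : v ≠ 0) :
    Function.Injective ((1 : Matrix d d ℂ) ⊗ₖ replicateCol Unit v).mulVec := by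
  intro x y h
  obtain ⟨k, hk⟩ := Function.ne_iff.mp hv
  funext ⟨i, u⟩
  have h' := congrFun h (i, k)
  simp only [mulVec, dotProduct, Fintype.sum_prod_type, kronecker_apply, one_apply,
    replicateCol_apply, Finset.univ_unique, Finset.sum_singleton, ite_mul, one_mul, zero_mul,
    Finset.sum_ite_eq, Finset.mem_univ, if_true] at h'
  exact mul_left_cancel₀ hk h'

/-- if `Φ⊗(EᵀPE) + Sym{Ψ⊗(EᵀPA) + I_d⊗(Q₀ᵀE₀ᵀA)} < 0` for some `P = Pᵀ > 0`
and `Q₀`, then for every `λ ∈ ℂ` and `v ∈ ℂⁿ` with `Av = λ Ev` and `Ev ≠ 0`, the matrix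
`Φ + λΨ + λ̄Ψᵀ` is negative definite. -/
theorem stmt_6 {n d r : ℕ} (E A : Matrix (Fin n) (Fin n) ℝ) (hr : E.rank = r)
    (E₀ : Matrix (Fin n) (Fin (n - r)) ℝ) (hE₀rank : E₀.rank = n - r)
    (hEE₀ : Eᵀ * E₀ = 0) (Φ Ψ : Matrix (Fin d) (Fin d) ℝ) (hΦ : Φ.IsSymm)
    (P : Matrix (Fin n) (Fin n) ℝ) (Q₀ : Matrix (Fin (n - r)) (Fin n) ℝ)
    (hP : P.PosDef)
    (hLMI : NegDef (Φ ⊗ₖ (Eᵀ * P * E) +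
      matSym (Ψ ⊗ₖ (Eᵀ * P * A) + (1 : Matrix (Fin d) (Fin d) ℝ) ⊗ₖ (Q₀ᵀ * E₀ᵀ * A)))) :
    ∀ (lam : ℂ) (v : Fin n → ℂ),
      A.map Complex.ofReal *ᵥ v = lam • (E.map Complex.ofReal *ᵥ v) →
      E.map Complex.ofReal *ᵥ v ≠ 0 →
      NegDefC (lmiMat Φ Ψ lam) := by
  intro lam v hv hEv
  set V : Matrix (Fin n) Unit ℂ := replicateCol Unit v with hV
  set E' := E.map Complex.ofReal with hE'
  set A' := A.map Complex.ofReal with hA'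
  set P' := P.map Complex.ofReal with hP'
  have hv0 : v ≠ 0 := by
    rintro rfl
    exact hEv (mulVec_zero _)
  have hAV : A' * V = lam • (E' * V) := by
    ext i j
    simpa [hV, mul_apply, mulVec, dotProduct] using congrFun hv i
  have hVA : Vᴴ * A'ᴴ = star lam • (Vᴴ * E'ᴴ) := by
    rw [← conjTranspose_mul, hAV, conjTranspose_smul, conjTranspose_mul]
  have hEV : E' * V = replicateCol Unit (E' *ᵥ v) := by
    ext i j
    simp [hV, mul_apply, mulVec, dotProduct]
  set W : Matrix Unit Unit ℂ := (E' * V)ᴴ * P' * (E' * V) with hW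
  have hWpos : 0 < W () () := by
    have h : W.PosDef := hP.map_ofReal.conjTranspose_mul_mul_same
      (by rw [hEV]; exact replicateCol_mulVec_injective hEv)
    exact h.diag_pos
  have hPt : Pᵀ = P := by rw [← conjTranspose_eq_transpose_of_trivial]; exact hP.isHermitian
  have hEE₀' : E₀ᵀ * E = 0 := by
    simpa using congrArg transpose hEE₀
  have hEPE : Vᴴ * (Eᵀ * P * E).map Complex.ofReal * V = W := by
    simp only [hW, map_ofReal_mul, ← conjTranspose_map_ofReal, conjTranspose_mul, Matrix.mul_assoc,
      hE', hP']
  have hEPA : Vᴴ * (Eᵀ * P * A).map Complex.ofReal * V = lam • W := by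
    simp only [hW, map_ofReal_mul, ← conjTranspose_map_ofReal, conjTranspose_mul, Matrix.mul_assoc]
    simp only [← hE', ← hP', ← hA', hAV, Matrix.mul_smul]
  have hEPAt : Vᴴ * (Eᵀ * P * A)ᵀ.map Complex.ofReal * V = star lam • W := by
    have h : (Eᵀ * P * A)ᵀ = Aᵀ * (P * E) := by
      simp only [transpose_mul, transpose_transpose, hPt]
    rw [h, map_ofReal_mul, map_ofReal_mul, ← conjTranspose_map_ofReal, ← Matrix.mul_assoc Vᴴ,
      hVA, hW, conjTranspose_mul]
    simp only [Matrix.smul_mul, Matrix.mul_assoc, hE', hP']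
  have hEEV : E₀ᵀ.map Complex.ofReal * (E' * V) = 0 := by
    rw [← Matrix.mul_assoc, ← map_ofReal_mul, hEE₀']
    ext; simp
  have hQ : Vᴴ * (Q₀ᵀ * E₀ᵀ * A).map Complex.ofReal * V = 0 := by
    simp only [map_ofReal_mul, Matrix.mul_assoc]
    rw [← hA', hAV, Matrix.mul_smul, hEEV]
    simp
  have hQt : Vᴴ * (Q₀ᵀ * E₀ᵀ * A)ᵀ.map Complex.ofReal * V = 0 := by
    rw [← conjTranspose_map_ofReal]
    simpa [Matrix.mul_assoc] using congrArg conjTranspose hQ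
  set B := (1 : Matrix (Fin d) (Fin d) ℂ) ⊗ₖ V with hB
  have hcompress (X : Matrix (Fin d) (Fin d) ℝ) (Y : Matrix (Fin n) (Fin n) ℝ) :
      Bᴴ * (X ⊗ₖ Y).map Complex.ofReal * B =
        X.map Complex.ofReal ⊗ₖ (Vᴴ * Y.map Complex.ofReal * V) := by
    rw [hB, map_ofReal_kronecker, conjTranspose_kronecker, ← mul_kronecker_mul,
      ← mul_kronecker_mul, conjTranspose_one, Matrix.one_mul, Matrix.mul_one]
  have hpos := (hLMI.map_ofReal.conjTranspose_mul_mul_same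
    (one_kronecker_replicateCol_mulVec_injective (d := Fin d) hv0))
  have hmap {m : Type} (M N : Matrix m m ℝ) :
      (M + N).map Complex.ofReal = M.map Complex.ofReal + N.map Complex.ofReal := by
    ext; simp
  have hneg {m : Type} (M : Matrix m m ℝ) :
      (-M).map Complex.ofReal = -M.map Complex.ofReal := by
    ext; simp
  rw [← hV, ← hB] at hpos
  simp only [matSym, transpose_add, hneg, hmap, ← kroneckerMap_transpose, Matrix.mul_add,
    Matrix.add_mul, Matrix.mul_neg, Matrix.neg_mul, hcompress, hEPE, hEPA, hEPAt, hQ, hQt,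
    kronecker_zero, add_zero] at hpos
  have hsub := hpos.submatrix (e := fun i : Fin d => (i, ())) (fun i j h => (Prod.mk.inj h).1)
  have hscale := hsub.smul (inv_pos.mpr hWpos)
  unfold NegDefC
  convert hscale using 1
  ext i j
  simp only [lmiMat, Matrix.neg_apply, Matrix.add_apply, Matrix.smul_apply, submatrix_apply, kronecker_apply,
    Matrix.map_apply, smul_eq_mul, starRingEnd_apply]
  field_simp [hWpos.ne']
  ring
end
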